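/- (Interval extension of floating-point multiplication, Lemma 2 for ×) Let x̲ ≤ x ≤ x̄ and y̲ ≤ y ≤ ȳ be real numbers, suppose −maxF ≤ x·y ≤ maxF, and let z be any directed rounding of x·y. Then D(min{x̲·y̲, x̲·ȳ, x̄·y̲, x̄·ȳ}) ≤ z ≤ U(max{x̲·y̲, x̲·ȳ, x̄·y̲, x̄·ȳ}). -/

import Mathlib

noncomputable section

/-- The maximum exponent `e_max = 2^(eb-1) - 1`, as an integer. -/
def emax (eb : ℕ) : ℤ := 2 ^ (eb - 1) - 1

/-- The set of finite floating-point numbers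
`F = { M · 2^(e - sb + 1) : M, e ∈ ℤ, |M| ≤ 2^sb - 1, 1 - e_max ≤ e ≤ e_max }`. -/
def Fset (eb sb : ℕ) : Set ℝ :=
  {x | ∃ M e : ℤ, |M| ≤ 2 ^ sb - 1 ∧ 1 - emax eb ≤ e ∧ e ≤ emax eb ∧
    x = (M : ℝ) * (2 : ℝ) ^ (e - (sb : ℤ) + 1)}

/-- `ed = 2^(sb-1)`. -/
def edc (sb : ℕ) : ℝ := 2 ^ (sb - 1)

/-- `em = (ed - 1) / (2^(e_max - 1) · ed)`. -/
def emc (eb sb : ℕ) : ℝ := (edc sb - 1) / ((2 : ℝ) ^ (emax eb - 1) * edc sb)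

/-- The largest finite floating-point number `maxF = (2^sb - 1) · 2^(e_max - sb + 1)`. -/
def maxF (eb sb : ℕ) : ℝ := ((2 : ℝ) ^ sb - 1) * (2 : ℝ) ^ (emax eb - (sb : ℤ) + 1)

/-- The downward rounding approximation `D(x) = x - |x|/ed - em`. -/
def Dr (eb sb : ℕ) (x : ℝ) : ℝ := x - |x| / edc sb - emc eb sb

/-- The upward rounding approximation `U(x) = x + |x|/ed + em`. -/
def Ur (eb sb : ℕ) (x : ℝ) : ℝ := x + |x| / edc sb + emc eb sb

/-- `z` is a directed rounding of `x`: the greatest element of `F` below `x`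
or the least element of `F` above `x`. -/
def DirRound (eb sb : ℕ) (x z : ℝ) : Prop :=
  IsGreatest {y ∈ Fset eb sb | y ≤ x} z ∨ IsLeast {y ∈ Fset eb sb | x ≤ y} z

theorem aux_neg (eb sb : ℕ) (f : ℝ) (hf : f ∈ Fset eb sb) : -f ∈ Fset eb sb := by
  obtain ⟨M, e, h1, h2, h3, rfl⟩ := hf
  exact ⟨-M, e, by rwa [abs_neg], h2, h3, by push_cast; ring⟩

theorem aux_floor (eb sb : ℕ) (hsb : 2 ≤ sb) (t : ℝ) (e : ℤ) (h1 : 1 - emax eb ≤ e)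
    (h2 : e ≤ emax eb) (ht : |t| < (2 : ℝ) ^ (e + 1)) (hm : |t| ≤ maxF eb sb) :
    ∃ f ∈ Fset eb sb, f ≤ t ∧ t - f ≤ (2 : ℝ) ^ (e - (sb : ℤ) + 1) := by
  set u : ℝ := (2 : ℝ) ^ (e - (sb : ℤ) + 1) with hu
  have hu0 : 0 < u := by positivity
  have hpow : (2 : ℝ) ^ (e + 1) = 2 ^ sb * u := by
    rw [hu, ← zpow_natCast, ← zpow_add₀ (by norm_num)]; congr 1; ring
  obtain ⟨ht1, ht2⟩ := abs_lt.mp ht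
  rw [hpow] at ht1 ht2
  set M : ℤ := ⌊t / u⌋ with hM
  have hMle : (M : ℝ) * u ≤ t := by
    rw [← le_div_iff₀ hu0]; exact Int.floor_le _
  have hMlt : t < ((M : ℝ) + 1) * u := by
    rw [← div_lt_iff₀ hu0]; exact Int.lt_floor_add_one _
  have hMu : M < 2 ^ sb := by
    have : (M : ℝ) < 2 ^ sb := lt_of_mul_lt_mul_right (lt_of_le_of_lt hMle ht2) hu0.le
    exact_mod_cast this
  have hMl : -(2 ^ sb) ≤ M := by
    rw [hM, Int.le_floor, le_div_iff₀ hu0]; push_cast; linarith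
  have herr : t - M * u ≤ u := by linarith
  by_cases hc : M = -(2 ^ sb)
  · have hlt : e < emax eb := by
      rcases lt_or_eq_of_le h2 with h | h
      · exact h
      · exfalso
        have h3 := (abs_le.mp hm).1
        rw [maxF, ← h, ← hu] at h3
        have : -(2 ^ sb) + 1 ≤ M := by
          rw [hM, Int.le_floor, le_div_iff₀ hu0]; push_cast; linarith
        omega
    have hs : (2 : ℤ) ^ sb = 2 * 2 ^ (sb - 1) := by
      rw [← pow_succ']; congr 1; omega
    have hp : (1 : ℤ) ≤ 2 ^ (sb - 1) := one_le_pow₀ (by norm_num)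
    refine ⟨M * u, ⟨-(2 ^ (sb - 1)), e + 1, ?_, by omega, by omega, ?_⟩, hMle, herr⟩
    · rw [abs_neg, abs_of_pos (by positivity)]; omega
    · rw [hc, hs, show e + 1 - (sb : ℤ) + 1 = (e - sb + 1) + 1 by ring, zpow_add_one₀ (by norm_num),
        ← hu]
      push_cast; ring
  · exact ⟨M * u, ⟨M, e, by rw [abs_le]; constructor <;> omega, h1, h2, rfl⟩, hMle, herr⟩

theorem aux_ed (sb : ℕ) (hsb : 2 ≤ sb) : 2 ≤ edc sb := by
  unfold edc
  calc (2 : ℝ) = 2 ^ 1 := by norm_num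
    _ ≤ 2 ^ (sb - 1) := pow_le_pow_right₀ (by norm_num) (by omega)

theorem aux_ulp (sb : ℕ) (hsb : 2 ≤ sb) (e : ℤ) :
    (2 : ℝ) ^ (e - (sb : ℤ) + 1) = 2 ^ e / edc sb := by
  unfold edc
  rw [← zpow_natCast, ← zpow_sub₀ (by norm_num)]; congr 1; push_cast [show 1 ≤ sb by omega]; ring

theorem aux_emc (eb sb : ℕ) :
    emc eb sb = (edc sb - 1) * ((2 : ℝ) ^ (1 - emax eb) / edc sb) := by
  unfold emc
  rw [show 1 - emax eb = -(emax eb - 1) by ring, zpow_neg, div_eq_mul_inv, mul_inv, ← div_eq_mul_inv]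

theorem aux_down (eb sb : ℕ) (heb : 2 ≤ eb) (hsb : 2 ≤ sb) (t : ℝ) (hm : |t| ≤ maxF eb sb) :
    ∃ f ∈ Fset eb sb, f ≤ t ∧ t - f ≤ |t| / edc sb + emc eb sb := by
  have hed := aux_ed sb hsb
  have hed0 : 0 < edc sb := by linarith
  have hemax : 1 ≤ emax eb := by
    unfold emax
    have : (2 : ℤ) ^ 1 ≤ 2 ^ (eb - 1) := pow_le_pow_right₀ (by norm_num) (by omega)
    omega
  have hq : 0 < (2 : ℝ) ^ (1 - emax eb) / edc sb := by positivity
  have hem : (2 : ℝ) ^ (1 - emax eb) / edc sb ≤ emc eb sb := by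
    rw [aux_emc]; nlinarith
  by_cases hc : |t| < (2 : ℝ) ^ (1 - emax eb)
  · obtain ⟨f, hf, h1, h2⟩ := aux_floor eb sb hsb t (1 - emax eb) le_rfl (by omega)
      (hc.trans_le (zpow_le_zpow_right₀ (by norm_num) (by omega))) hm
    rw [aux_ulp sb hsb] at h2
    have : 0 ≤ |t| / edc sb := by positivity
    exact ⟨f, hf, h1, by linarith⟩
  · push Not at hc
    have ht0 : 0 < |t| := lt_of_lt_of_le (by positivity) hc
    have hl1 : (2 : ℝ) ^ (Int.log 2 |t|) ≤ |t| := by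
      simpa using Int.zpow_log_le_self (b := 2) (by norm_num) ht0
    have hl2 : |t| < (2 : ℝ) ^ (Int.log 2 |t| + 1) := by
      simpa using Int.lt_zpow_succ_log_self (b := 2) (by norm_num) |t|
    have he1 : 1 - emax eb ≤ Int.log 2 |t| := by
      have := (zpow_lt_zpow_iff_right₀ (by norm_num : (1 : ℝ) < 2)).mp (hc.trans_lt hl2)
      omega
    have hmax : maxF eb sb < (2 : ℝ) ^ (emax eb + 1) := by
      have : (2 : ℝ) ^ (emax eb + 1) = 2 ^ sb * (2 : ℝ) ^ (emax eb - (sb : ℤ) + 1) := by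
        rw [← zpow_natCast, ← zpow_add₀ (by norm_num)]; congr 1; ring
      rw [this, maxF]
      have : 0 < (2 : ℝ) ^ (emax eb - (sb : ℤ) + 1) := by positivity
      linarith
    have he2 : Int.log 2 |t| ≤ emax eb := by
      have := (zpow_lt_zpow_iff_right₀ (by norm_num : (1 : ℝ) < 2)).mp
        ((hl1.trans hm).trans_lt hmax)
      omega
    obtain ⟨f, hf, h1, h2⟩ := aux_floor eb sb hsb t _ he1 he2 hl2 hm
    rw [aux_ulp sb hsb] at h2
    have : (2 : ℝ) ^ (Int.log 2 |t|) / edc sb ≤ |t| / edc sb := by gcongr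
    exact ⟨f, hf, h1, by linarith⟩

theorem aux_round (eb sb : ℕ) (heb : 2 ≤ eb) (hsb : 2 ≤ sb) (t z : ℝ) (hm : |t| ≤ maxF eb sb)
    (hz : DirRound eb sb t z) : Dr eb sb t ≤ z ∧ z ≤ Ur eb sb t := by
  obtain ⟨f, hf, f1, f2⟩ := aux_down eb sb heb hsb t hm
  obtain ⟨g, hg, g1, g2⟩ := aux_down eb sb heb hsb (-t) (by rwa [abs_neg])
  rw [abs_neg] at g2
  unfold Dr Ur
  rcases hz with ⟨⟨_, h1⟩, h2⟩ | ⟨⟨_, h1⟩, h2⟩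
  · have := h2 ⟨hf, f1⟩
    have h1 : z ≤ t := h1
    constructor <;> linarith
  · have := h2 ⟨aux_neg eb sb g hg, by linarith⟩
    have h1 : t ≤ z := h1
    constructor <;> linarith

theorem aux_abs (sb : ℕ) (hsb : 2 ≤ sb) (a b : ℝ) (h : a ≤ b) :
    |(|b| / edc sb - |a| / edc sb)| ≤ b - a := by
  have hed := aux_ed sb hsb
  rw [← sub_div, abs_div, abs_of_pos (by linarith : 0 < edc sb), div_le_iff₀ (by linarith)]
  have h1 := abs_abs_sub_abs_le b a
  rw [abs_of_nonneg (sub_nonneg.mpr h)] at h1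
  nlinarith

theorem aux_max (xl x xu yl y yu : ℝ)
    (hx1 : xl ≤ x) (hx2 : x ≤ xu) (hy1 : yl ≤ y) (hy2 : y ≤ yu) :
    x * y ≤ max (max (xl * yl) (xl * yu)) (max (xu * yl) (xu * yu)) := by
  have key : x * y ≤ max (xl * y) (xu * y) := by
    rcases le_total 0 y with h | h
    · exact le_max_of_le_right (by nlinarith)
    · exact le_max_of_le_left (by nlinarith)
  have k2 : ∀ a : ℝ, a * y ≤ max (a * yl) (a * yu) := by
    intro a
    rcases le_total 0 a with h | h
    · exact le_max_of_le_right (by nlinarith)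
    · exact le_max_of_le_left (by nlinarith)
  exact key.trans (max_le_max (k2 xl) (k2 xu))

theorem aux_min (xl x xu yl y yu : ℝ)
    (hx1 : xl ≤ x) (hx2 : x ≤ xu) (hy1 : yl ≤ y) (hy2 : y ≤ yu) :
    min (min (xl * yl) (xl * yu)) (min (xu * yl) (xu * yu)) ≤ x * y := by
  have key : min (xl * y) (xu * y) ≤ x * y := by
    rcases le_total 0 y with h | h
    · exact min_le_of_left_le (by nlinarith)
    · exact min_le_of_right_le (by nlinarith)
  have k2 : ∀ a : ℝ, min (a * yl) (a * yu) ≤ a * y := by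
    intro a
    rcases le_total 0 a with h | h
    · exact min_le_of_left_le (by nlinarith)
    · exact min_le_of_right_le (by nlinarith)
  exact (min_le_min (k2 xl) (k2 xu)).trans key

theorem stmt7 (eb sb : ℕ) (heb : 2 ≤ eb) (hsb : 2 ≤ sb)
    (xl x xu yl y yu : ℝ)
    (hx1 : xl ≤ x) (hx2 : x ≤ xu) (hy1 : yl ≤ y) (hy2 : y ≤ yu)
    (hs1 : -maxF eb sb ≤ x * y) (hs2 : x * y ≤ maxF eb sb)
    (z : ℝ) (hz : DirRound eb sb (x * y) z) :
    Dr eb sb (min (min (xl * yl) (xl * yu)) (min (xu * yl) (xu * yu))) ≤ z ∧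
      z ≤ Ur eb sb (max (max (xl * yl) (xl * yu)) (max (xu * yl) (xu * yu))) := by
  obtain ⟨h1, h2⟩ := aux_round eb sb heb hsb (x * y) z (abs_le.mpr ⟨hs1, hs2⟩) hz
  have a := abs_le.mp (aux_abs sb hsb _ _ (aux_min xl x xu yl y yu hx1 hx2 hy1 hy2))
  have b := abs_le.mp (aux_abs sb hsb _ _ (aux_max xl x xu yl y yu hx1 hx2 hy1 hy2))
  unfold Dr Ur at *
  constructor
  · linarith [a.1, a.2]
  · linarith [b.1, b.2]
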